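/- Let κ₁, κ₂, κ₃, κ₄ > 0 with κ₁ > κ₂ + κ₃. Then every complex root of the polynomial λ³ + a₂λ² + a₁λ + a₀, where a₂ = 2√(κ₁κ₃κ₄/κ₂), a₁ = (κ₁ + κ₂ − κ₃)κ₄, a₀ = 4√(κ₁κ₂κ₃κ₄³), has negative real part. In particular, every eigenvalue of the Jacobian of system (2) at the positive equilibrium has negative real part. -/

import Mathlib

/-- The right-hand side of the mass-action system (2). -/
noncomputable def massActionField (κ₁ κ₂ κ₃ κ₄ : ℝ) (v : Fin 3 → ℝ) : Fin 3 → ℝ :=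
  ![v 0 * (κ₁ * v 2 - κ₂ * v 1),
    v 1 * (κ₂ * v 0 - κ₃ * v 2),
    v 2 * (-(κ₃ * v 1) - κ₁ * v 0) + 2 * κ₄]

/-- The Jacobian matrix of the right-hand side of system (2) at the positive equilibrium. -/
noncomputable def jacobianAtEq (κ₁ κ₂ κ₃ κ₄ : ℝ) : Matrix (Fin 3) (Fin 3) ℝ := fun i j =>
  fderiv ℝ (massActionField κ₁ κ₂ κ₃ κ₄)
    ![Real.sqrt (κ₃ * κ₄ / (κ₁ * κ₂)), Real.sqrt (κ₁ * κ₄ / (κ₂ * κ₃)),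
      Real.sqrt (κ₂ * κ₄ / (κ₁ * κ₃))] (Pi.single j 1) i

theorem rh_cubic (a b c : ℝ) (ha : 0 < a) (hb : 0 < b) (hc : 0 < c) (h : c < a * b) (l : ℂ)
    (hl : l ^ 3 + (a : ℂ) * l ^ 2 + (b : ℂ) * l + (c : ℂ) = 0) : l.re < 0 := by
  obtain ⟨p, q⟩ := l
  have h1 := congrArg Complex.re hl
  have h2 := congrArg Complex.im hl
  simp [pow_succ] at h1 h2
  show p < 0
  by_contra hp
  push Not at hp
  by_cases hq : q = 0
  · subst hq
    have : 0 < p * p * p + a * (p * p) + b * p + c := by positivity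
    nlinarith
  · have h3 : q ^ 2 = 3 * p ^ 2 + 2 * a * p + b := by
      apply mul_left_cancel₀ hq
      linarith
    have h4 : 8 * p ^ 3 + 8 * a * p ^ 2 + (2 * b + 2 * a ^ 2) * p + (a * b - c) = 0 := by
      linear_combination (-1) * h1 - (3 * p + a) * h3
    have : 0 ≤ 8 * p ^ 3 + 8 * a * p ^ 2 + (2 * b + 2 * a ^ 2) * p := by positivity
    linarith

theorem field_fderiv (κ₁ κ₂ κ₃ κ₄ : ℝ) (v w : Fin 3 → ℝ) :
    fderiv ℝ (massActionField κ₁ κ₂ κ₃ κ₄) v w =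
    ![w 0 * (κ₁ * v 2 - κ₂ * v 1) + v 0 * (κ₁ * w 2 - κ₂ * w 1),
      w 1 * (κ₂ * v 0 - κ₃ * v 2) + v 1 * (κ₂ * w 0 - κ₃ * w 2),
      w 2 * (-(κ₃ * v 1) - κ₁ * v 0) + v 2 * (-(κ₃ * w 1) - κ₁ * w 0)] := by
  have hd : DifferentiableAt ℝ (massActionField κ₁ κ₂ κ₃ κ₄) v := by
    rw [differentiableAt_pi]
    intro i
    fin_cases i <;> simp [massActionField] <;> fun_prop
  have hL : HasDerivAt (fun t : ℝ => v + t • w) w 0 := by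
    simpa using ((hasDerivAt_id (0:ℝ)).smul_const w).const_add v
  have hd' : HasFDerivAt (massActionField κ₁ κ₂ κ₃ κ₄) (fderiv ℝ (massActionField κ₁ κ₂ κ₃ κ₄) v)
      (v + (0:ℝ) • w) := by simpa using hd.hasFDerivAt
  have hc := hd'.comp_hasDerivAt (0:ℝ) hL
  have hx : ∀ i, HasDerivAt (fun t : ℝ => v i + t * w i) (w i) 0 := by
    intro i
    simpa using ((hasDerivAt_id (0:ℝ)).mul_const (w i)).const_add (v i)
  refine hc.unique ?_
  rw [hasDerivAt_pi]
  intro i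
  fin_cases i
  · have := (hx 0).mul (((hx 2).const_mul κ₁).sub ((hx 1).const_mul κ₂))
    refine HasDerivAt.congr_deriv this ?_
    simp
  · have := (hx 1).mul (((hx 0).const_mul κ₂).sub ((hx 2).const_mul κ₃))
    refine HasDerivAt.congr_deriv this ?_
    simp
  · have := ((hx 2).mul ((((hx 1).const_mul κ₃).neg).sub ((hx 0).const_mul κ₁))).add_const (2 * κ₄)
    refine HasDerivAt.congr_deriv this ?_
    simp

/-- If κ₁ > κ₂ + κ₃, every complex root of λ³ + a₂λ² + a₁λ + a₀ (with
a₂ = 2√(κ₁κ₃κ₄/κ₂), a₁ = (κ₁+κ₂−κ₃)κ₄, a₀ = 4√(κ₁κ₂κ₃κ₄³)) has negative real part;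
in particular, every eigenvalue of the Jacobian of system (2) at the positive equilibrium
has negative real part. -/
theorem roots_neg_re_of_gt
    (κ₁ κ₂ κ₃ κ₄ : ℝ) (hκ₁ : 0 < κ₁) (hκ₂ : 0 < κ₂) (hκ₃ : 0 < κ₃) (hκ₄ : 0 < κ₄)
    (hgt : κ₂ + κ₃ < κ₁) :
    (∀ lam : ℂ,
      lam ^ 3 + (2 * Real.sqrt (κ₁ * κ₃ * κ₄ / κ₂) : ℝ) * lam ^ 2
        + ((κ₁ + κ₂ - κ₃) * κ₄ : ℝ) * lam
        + (4 * Real.sqrt (κ₁ * κ₂ * κ₃ * κ₄ ^ 3) : ℝ) = 0 → lam.re < 0) ∧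
    (∀ μ ∈ spectrum ℂ ((jacobianAtEq κ₁ κ₂ κ₃ κ₄).map (Complex.ofReal ·)), μ.re < 0) := by
  obtain ⟨s, hs, hs2⟩ : ∃ s : ℝ, 0 < s ∧ s ^ 2 = κ₁ * κ₂ * κ₃ * κ₄ :=
    ⟨Real.sqrt (κ₁ * κ₂ * κ₃ * κ₄), by positivity, Real.sq_sqrt (by positivity)⟩
  have e2 : Real.sqrt (κ₁ * κ₃ * κ₄ / κ₂) = s / κ₂ := by
    rw [Real.sqrt_eq_iff_mul_self_eq_of_pos (by positivity), ← sq, div_pow, hs2]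
    field_simp
  have e0 : Real.sqrt (κ₁ * κ₂ * κ₃ * κ₄ ^ 3) = κ₄ * s := by
    rw [Real.sqrt_eq_iff_mul_self_eq_of_pos (by positivity), ← sq, mul_pow, hs2]
    ring
  have ex : Real.sqrt (κ₃ * κ₄ / (κ₁ * κ₂)) = s / (κ₁ * κ₂) := by
    rw [Real.sqrt_eq_iff_mul_self_eq_of_pos (by positivity), ← sq, div_pow, hs2]
    field_simp
  have ey : Real.sqrt (κ₁ * κ₄ / (κ₂ * κ₃)) = s / (κ₂ * κ₃) := by
    rw [Real.sqrt_eq_iff_mul_self_eq_of_pos (by positivity), ← sq, div_pow, hs2]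
    field_simp
  have ez : Real.sqrt (κ₂ * κ₄ / (κ₁ * κ₃)) = s / (κ₁ * κ₃) := by
    rw [Real.sqrt_eq_iff_mul_self_eq_of_pos (by positivity), ← sq, div_pow, hs2]
    field_simp
  have key : ∀ lam : ℂ,
      lam ^ 3 + (2 * Real.sqrt (κ₁ * κ₃ * κ₄ / κ₂) : ℝ) * lam ^ 2
        + ((κ₁ + κ₂ - κ₃) * κ₄ : ℝ) * lam
        + (4 * Real.sqrt (κ₁ * κ₂ * κ₃ * κ₄ ^ 3) : ℝ) = 0 → lam.re < 0 := by
    intro lam hl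
    rw [e2, e0] at hl
    refine rh_cubic _ _ _ (by positivity) (mul_pos (by linarith) hκ₄) (by positivity) ?_ lam hl
    have : 2 * (s / κ₂) * ((κ₁ + κ₂ - κ₃) * κ₄) - 4 * (κ₄ * s)
        = 2 * s * κ₄ / κ₂ * (κ₁ - κ₂ - κ₃) := by
      field_simp
      ring
    have h2 : 0 < 2 * s * κ₄ / κ₂ * (κ₁ - κ₂ - κ₃) := mul_pos (by positivity) (by linarith)
    linarith
  refine ⟨key, ?_⟩
  intro μ hμ
  apply key
  rw [e2, e0]
  have hJ : jacobianAtEq κ₁ κ₂ κ₃ κ₄ =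
      !![0, -(s / κ₁), s / κ₂; s / κ₃, 0, -(s / κ₂); -(s / κ₃), -(s / κ₁), -(2 * s / κ₂)] := by
    ext i j
    rw [jacobianAtEq, field_fderiv, ex, ey, ez]
    fin_cases i <;> fin_cases j <;> simp <;> field_simp <;> ring
  rw [hJ, spectrum.mem_iff, Matrix.isUnit_iff_isUnit_det, isUnit_iff_ne_zero, not_not,
    Matrix.det_fin_three] at hμ
  simp [Matrix.algebraMap_matrix_apply] at hμ
  have hs2' : (s : ℂ) ^ 2 = κ₁ * κ₂ * κ₃ * κ₄ := by exact_mod_cast hs2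
  have k1 : (κ₁ : ℂ) ≠ 0 := by exact_mod_cast hκ₁.ne'
  have k2 : (κ₂ : ℂ) ≠ 0 := by exact_mod_cast hκ₂.ne'
  have k3 : (κ₃ : ℂ) ≠ 0 := by exact_mod_cast hκ₃.ne'
  have k4 : (κ₄ : ℂ) = s ^ 2 / (κ₁ * κ₂ * κ₃) := by
    rw [hs2']
    field_simp
  push_cast
  rw [k4, ← hμ]
  field_simp
  ring
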